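/- arXiv:1706.05965 — 15 statements merged into one kernel-verified Lean document; each statement's English description precedes it below -/
import Mathlib

section
/- For every M > 0 there exists T > 0 such that for all real numbers t, α with 0 ≤ t ≤ T and 0 ≤ α ≤ T, and all real numbers β₀, β₁, β₂ with |β₂| ≤ M, 27β₀² ≤ 4α³ and 3β₁² ≤ α, one has 4(t+α)³ − 27(β₀ + tβ₁ + t²β₂)² ≥ 2 t²(t+α). -/
/-- Lemma 2.1 (first part): condition (H) under the bound 3β₁² ≤ α. -/
theorem stmt_0 (M : ℝ) (hM : 0 < M) :
    ∃ T : ℝ, 0 < T ∧ ∀ t α β₀ β₁ β₂ : ℝ,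
      0 ≤ t → t ≤ T → 0 ≤ α → α ≤ T → |β₂| ≤ M →
      27 * β₀ ^ 2 ≤ 4 * α ^ 3 → 3 * β₁ ^ 2 ≤ α →
      4 * (t + α) ^ 3 - 27 * (β₀ + t * β₁ + t ^ 2 * β₂) ^ 2 ≥ 2 * t ^ 2 * (t + α) := by
  refine ⟨(1 / (48 * M)) ^ 2, by positivity, ?_⟩
  intro t α β₀ β₁ β₂ ht htT hα hαT h₂ h₀ h₁
  obtain ⟨a, ha, rfl⟩ : ∃ a : ℝ, 0 ≤ a ∧ a ^ 2 = α :=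
    ⟨√α, Real.sqrt_nonneg α, Real.sq_sqrt hα⟩
  have hMa : M * a ≤ 1 / 48 := by
    have h : a ≤ 1 / (48 * M) := le_of_sq_le_sq hαT (by positivity)
    rw [le_div_iff₀ (by positivity)] at h
    linarith
  have hMt : M ^ 2 * t ≤ 1 / 2304 := by
    calc M ^ 2 * t ≤ M ^ 2 * (1 / (48 * M)) ^ 2 := by gcongr
      _ = 1 / 2304 := by field_simp; norm_num
  -- Rescale the coefficients by `√27` so that the bounds become rational.
  obtain ⟨k, hk, hk27⟩ : ∃ k : ℝ, 0 ≤ k ∧ k ^ 2 = 27 :=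
    ⟨√27, Real.sqrt_nonneg _, Real.sq_sqrt (by norm_num)⟩
  have hk6 : k ≤ 6 := by nlinarith
  have hX : |k * β₀| ≤ 2 * a ^ 3 :=
    abs_le_of_sq_le_sq (by rw [mul_pow, hk27]; linarith) (by positivity)
  have hY : |k * β₁| ≤ 3 * a :=
    abs_le_of_sq_le_sq (by rw [mul_pow, hk27]; linarith) (by positivity)
  have hZ : |k * β₂| ≤ 6 * M := by
    rw [abs_mul, abs_of_nonneg hk]
    gcongr
  have hW : |k * (β₀ + t * β₁ + t ^ 2 * β₂)| ≤ 2 * a ^ 3 + t * (3 * a) + t ^ 2 * (6 * M) := by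
    calc |k * (β₀ + t * β₁ + t ^ 2 * β₂)|
        = |k * β₀ + t * (k * β₁) + t ^ 2 * (k * β₂)| := by ring_nf
      _ ≤ |k * β₀| + |t * (k * β₁)| + |t ^ 2 * (k * β₂)| := abs_add_three _ _ _
      _ = |k * β₀| + t * |k * β₁| + t ^ 2 * |k * β₂| := by
        rw [abs_mul t, abs_mul (t ^ 2), abs_of_nonneg ht, abs_of_nonneg (sq_nonneg t)]
      _ ≤ _ := by gcongr
  have hsq := sq_le_sq' (abs_le.mp hW).1 (abs_le.mp hW).2
  rw [mul_pow, hk27] at hsq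
  have e₁ : t ^ 2 * a ^ 2 * (M * a) ≤ t ^ 2 * a ^ 2 * (1 / 48) := by gcongr
  have e₂ : t ^ 3 * (M * a) ≤ t ^ 3 * (1 / 48) := by gcongr
  have e₃ : t ^ 3 * (M ^ 2 * t) ≤ t ^ 3 * (1 / 2304) := by gcongr
  have p₁ : 0 ≤ t ^ 3 := by positivity
  have p₂ : 0 ≤ t ^ 2 * a ^ 2 := by positivity
  nlinarith
end

section
/- For every M > 0 and every ε with 0 < ε < 1 there exist T > 0 and δ > 0 such that for all real numbers t, α with 0 ≤ t ≤ T and 0 ≤ α ≤ T, and all real numbers β₀, β₁, β₂ with |β₂| ≤ M, 27β₀² ≤ 4α³ and |β₁| ≤ ((1−ε)/√3)·√α, one has 4(t+α)³ − 27(β₀ + tβ₁ + t²β₂)² ≥ δ t(t+α)². -/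
/-- The polynomial inequality behind condition (E), in the variable `s = √α`. -/
lemma discriminant_lower_bound {ε K η s t : ℝ} (hε : 0 < ε) (hε1 : ε < 1) (hK : 0 ≤ K)
    (hs : 0 ≤ s) (hsη : s ≤ η) (ht : 0 ≤ t) (htη : t ≤ η)
    (hη : (10 * K + K ^ 2) * η ≤ ε) :
    (2 * s ^ 3 + t * (3 * (1 - ε) * s) + t ^ 2 * K) ^ 2 + ε * t * (t + s ^ 2) ^ 2
      ≤ 4 * (t + s ^ 2) ^ 3 := by
  have hη0 : 0 ≤ η := hs.trans hsη
  have h₁ : 4 * K * s * (t * s ^ 2) ≤ ε * (t * s ^ 2) := by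
    have : 4 * K * s ≤ ε := by
      have : 0 ≤ K * η := by positivity
      have : 0 ≤ K ^ 2 * η := by positivity
      nlinarith [mul_le_mul_of_nonneg_left hsη hK]
    gcongr
  have h₂ : (6 * K * (1 - ε) * s + K ^ 2 * t) * t ^ 2 ≤ ε * t ^ 2 := by
    have hKs := mul_le_mul_of_nonneg_left hsη hK
    have hKt := mul_le_mul_of_nonneg_left htη (sq_nonneg K)
    have hKεs : 0 ≤ K * s * ε := by positivity
    have : 6 * K * (1 - ε) * s + K ^ 2 * t ≤ ε := by nlinarith
    gcongr
  have h₃ : 0 ≤ 11 * ε * s ^ 4 + (3 - 3 * ε + 9 * ε * (2 - ε)) * (t * s ^ 2)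
      + (4 - 2 * ε) * t ^ 2 := by
    have : 0 ≤ 3 - 3 * ε + 9 * ε * (2 - ε) := by nlinarith
    have : 0 ≤ 4 - 2 * ε := by linarith
    positivity
  have h₄ : 0 ≤ 12 * ε * s ^ 4 + (12 - 9 * (1 - ε) ^ 2) * (t * s ^ 2) + 4 * t ^ 2
      - 4 * K * s * (t * s ^ 2) - (6 * K * (1 - ε) * s + K ^ 2 * t) * t ^ 2
      - ε * (t + s ^ 2) ^ 2 := by
    linarith
  linarith [mul_nonneg ht h₄]

/-- Lemma 2.1 (second part): condition (E) under the bound |β₁| ≤ ((1-ε)/√3)√α. -/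
theorem stmt_1 (M ε : ℝ) (hM : 0 < M) (hε : 0 < ε) (hε1 : ε < 1) :
    ∃ T : ℝ, 0 < T ∧ ∃ δ : ℝ, 0 < δ ∧ ∀ t α β₀ β₁ β₂ : ℝ,
      0 ≤ t → t ≤ T → 0 ≤ α → α ≤ T → |β₂| ≤ M →
      27 * β₀ ^ 2 ≤ 4 * α ^ 3 →
      |β₁| ≤ (1 - ε) / Real.sqrt 3 * Real.sqrt α →
      4 * (t + α) ^ 3 - 27 * (β₀ + t * β₁ + t ^ 2 * β₂) ^ 2 ≥ δ * t * (t + α) ^ 2 := by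
  set K : ℝ := 6 * M with hKdef
  have hK : 0 ≤ K := by positivity
  set η : ℝ := ε / (10 * K + K ^ 2 + 1) with hηdef
  have hη0 : 0 < η := by positivity
  have hηε : (10 * K + K ^ 2 + 1) * η = ε := by rw [hηdef]; field_simp
  have hη : (10 * K + K ^ 2) * η ≤ ε := by linarith
  have hη1 : η ≤ 1 := by
    have : 0 ≤ (10 * K + K ^ 2) * η := by positivity
    linarith
  refine ⟨η ^ 2, by positivity, ε, hε, fun t α β₀ β₁ β₂ ht htT hα hαT h₂ h₀ h₁ => ?_⟩
  have hs : 0 ≤ √α := Real.sqrt_nonneg α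
  have hsα : √α ^ 2 = α := Real.sq_sqrt hα
  have hsη : √α ≤ η := Real.sqrt_le_iff.mpr ⟨hη0.le, hαT⟩
  have htη : t ≤ η := by nlinarith
  have hr : 0 < √(3 : ℝ) := by positivity
  have hr2 : √(3 : ℝ) ^ 2 = 3 := Real.sq_sqrt (by norm_num)
  have hb₀ : |3 * √3 * β₀| ≤ 2 * √α ^ 3 := by
    refine abs_le_of_sq_le_sq ?_ (by positivity)
    calc (3 * √3 * β₀) ^ 2 = 9 * √3 ^ 2 * β₀ ^ 2 := by ring
      _ = 27 * β₀ ^ 2 := by rw [hr2]; ring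
      _ ≤ 4 * (√α ^ 2) ^ 3 := by rwa [hsα]
      _ = (2 * √α ^ 3) ^ 2 := by ring
  have hb₁ : |3 * √3 * β₁| ≤ 3 * (1 - ε) * √α := by
    rw [abs_mul, abs_of_pos (by positivity : 0 < 3 * √(3 : ℝ))]
    calc 3 * √3 * |β₁| ≤ 3 * √3 * ((1 - ε) / √3 * √α) := by gcongr
      _ = 3 * (1 - ε) * √α := by field_simp
  have hb₂ : |3 * √3 * β₂| ≤ K := by
    rw [abs_mul, abs_of_pos (by positivity : 0 < 3 * √(3 : ℝ))]
    have : √(3 : ℝ) ≤ 2 := Real.sqrt_le_iff.mpr (by norm_num)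
    calc 3 * √3 * |β₂| ≤ 3 * 2 * M := by gcongr
      _ = K := by rw [hKdef]; ring
  have hb : |3 * √3 * (β₀ + t * β₁ + t ^ 2 * β₂)|
      ≤ 2 * √α ^ 3 + t * (3 * (1 - ε) * √α) + t ^ 2 * K := by
    calc |3 * √3 * (β₀ + t * β₁ + t ^ 2 * β₂)|
        = |3 * √3 * β₀ + t * (3 * √3 * β₁) + t ^ 2 * (3 * √3 * β₂)| := by ring_nf
      _ ≤ |3 * √3 * β₀| + |t * (3 * √3 * β₁)| + |t ^ 2 * (3 * √3 * β₂)| := abs_add_three _ _ _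
      _ = |3 * √3 * β₀| + t * |3 * √3 * β₁| + t ^ 2 * |3 * √3 * β₂| := by
        rw [abs_mul t, abs_mul (t ^ 2), abs_of_nonneg ht, abs_of_nonneg (sq_nonneg t)]
      _ ≤ _ := by gcongr
  have hsq : 27 * (β₀ + t * β₁ + t ^ 2 * β₂) ^ 2
      ≤ (2 * √α ^ 3 + t * (3 * (1 - ε) * √α) + t ^ 2 * K) ^ 2 := by
    calc 27 * (β₀ + t * β₁ + t ^ 2 * β₂) ^ 2
        = 9 * √3 ^ 2 * (β₀ + t * β₁ + t ^ 2 * β₂) ^ 2 := by rw [hr2]; ring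
      _ = |3 * √3 * (β₀ + t * β₁ + t ^ 2 * β₂)| ^ 2 := by rw [sq_abs]; ring
      _ ≤ _ := by gcongr
  have hmain := discriminant_lower_bound hε hε1 hK hs hsη ht htη hη
  rw [hsα] at hmain
  linarith
end

section
/- For every integer m ≥ 2 and all real numbers t, α with 0 ≤ t ≤ 1 and α ≥ 0, one has the identity 4(t+α)³ − 27(t^m/2 − t)²·α = (t − 2α)²(4t + α) + 27 t^{m+1} α (1 − t^{m−1}/4); in particular 4(t+α)³ − 27(t^m/2 − t)²·α ≥ 0 for 0 ≤ t ≤ 1 and α ≥ 0. -/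
/-- Example 2.2: discriminant identity and hyperbolicity. -/
theorem stmt_2 (m : ℕ) (hm : 2 ≤ m) (t α : ℝ) (ht0 : 0 ≤ t) (ht1 : t ≤ 1) (hα : 0 ≤ α) :
    4 * (t + α) ^ 3 - 27 * (t ^ m / 2 - t) ^ 2 * α
      = (t - 2 * α) ^ 2 * (4 * t + α) + 27 * t ^ (m + 1) * α * (1 - t ^ (m - 1) / 4)
    ∧ 0 ≤ 4 * (t + α) ^ 3 - 27 * (t ^ m / 2 - t) ^ 2 * α := by
  have key : 4 * (t + α) ^ 3 - 27 * (t ^ m / 2 - t) ^ 2 * α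
      = (t - 2 * α) ^ 2 * (4 * t + α) + 27 * t ^ (m + 1) * α * (1 - t ^ (m - 1) / 4) := by
    obtain ⟨k, rfl⟩ : ∃ k, m = k + 1 := ⟨m - 1, by omega⟩
    rw [Nat.add_sub_cancel]
    ring
  refine ⟨key, ?_⟩
  rw [key]
  have hpow : t ^ (m - 1) ≤ 1 := pow_le_one₀ ht0 ht1
  have hfactor : 0 ≤ 1 - t ^ (m - 1) / 4 := by linarith
  positivity
end

section
/- Let m, k, q be nonnegative integers with m ≥ 2 and m > k + q − 2. Then for every δ > 0 and every ε > 0 there exist real numbers t, α with 0 < t < ε and 0 < α < ε such that 4(t+α)³ − 27(t^m/2 − t)²·α < δ · t^k · (t+α)^q. -/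
/-- Example 2.2: no estimate Δ ≥ δ t^k (t+α)^q holds near (0,0) when m > k + q - 2. -/
theorem stmt_3 (m k q : ℕ) (hm : 2 ≤ m) (hmkq : (m : ℤ) > (k : ℤ) + (q : ℤ) - 2) :
    ∀ δ : ℝ, 0 < δ → ∀ ε : ℝ, 0 < ε → ∃ t α : ℝ,
      0 < t ∧ t < ε ∧ 0 < α ∧ α < ε ∧
      4 * (t + α) ^ 3 - 27 * (t ^ m / 2 - t) ^ 2 * α < δ * t ^ k * (t + α) ^ q := by
  intro δ hδ ε hε
  obtain ⟨s, hs0, hs⟩ := exists_between (show (0 : ℝ) < min 1 (min ε (δ / 14)) by positivity)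
  obtain ⟨hs1, hs⟩ := lt_min_iff.mp hs
  obtain ⟨hsε, hsδ⟩ := lt_min_iff.mp hs
  refine ⟨s, s / 2, hs0, hsε, by positivity, by linarith, ?_⟩
  have hpow : s ^ (m + 2) ≤ s ^ (k + q + 1) :=
    pow_le_pow_of_le_one hs0.le hs1.le (by omega)
  have hq : s ^ q ≤ (s + s / 2) ^ q := pow_le_pow_left₀ hs0.le (by linarith) q
  calc 4 * (s + s / 2) ^ 3 - 27 * (s ^ m / 2 - s) ^ 2 * (s / 2)
      = 27 / 2 * s ^ (m + 2) - 27 / 8 * (s * (s ^ m) ^ 2) := by ring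
    _ < 27 / 2 * s ^ (m + 2) := sub_lt_self _ (by positivity)
    _ ≤ 27 / 2 * s ^ (k + q + 1) := by gcongr
    _ = (27 / 2 * s) * (s ^ k * s ^ q) := by ring
    _ ≤ δ * (s ^ k * s ^ q) := by
      gcongr
      linarith
    _ = δ * s ^ k * s ^ q := by ring
    _ ≤ δ * s ^ k * (s + s / 2) ^ q := by gcongr
end

section
/- For all constants c₀, C₀, δ with 0 < c₀ ≤ C₀ and δ > 0, there exist c₁ > 0 and T > 0 such that: for all real t, α with 0 ≤ t ≤ T and 0 ≤ α ≤ T, and all real a, b satisfying c₀(t+α) ≤ a ≤ C₀(t+α) and 4a³ − 27b² ≥ δ t²(t+α), every real root λ of the cubic equation λ³ − aλ + b = 0 satisfies |3λ² − a| ≥ c₁ t. -/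
/-- At a root of a depressed cubic, the discriminant factors through the derivative there. -/
theorem depressed_cubic_discrim_eq {R : Type*} [CommRing R] {a b x : R}
    (h : x ^ 3 - a * x + b = 0) :
    4 * a ^ 3 - 27 * b ^ 2 = (3 * x ^ 2 - a) ^ 2 * (4 * a - 3 * x ^ 2) := by
  obtain rfl : b = a * x - x ^ 3 := by linear_combination h
  ring

/-- Proposition 2.3 (first part): under condition (H), |∂_τ p| ≥ c₁ t at every real root. -/
theorem stmt_4 (c₀ C₀ δ : ℝ) (hc₀ : 0 < c₀) (hcC : c₀ ≤ C₀) (hδ : 0 < δ) :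
    ∃ c₁ : ℝ, 0 < c₁ ∧ ∃ T : ℝ, 0 < T ∧ ∀ t α a b lam : ℝ,
      0 ≤ t → t ≤ T → 0 ≤ α → α ≤ T →
      c₀ * (t + α) ≤ a → a ≤ C₀ * (t + α) →
      4 * a ^ 3 - 27 * b ^ 2 ≥ δ * t ^ 2 * (t + α) →
      lam ^ 3 - a * lam + b = 0 →
      |3 * lam ^ 2 - a| ≥ c₁ * t := by
  have hC₀ : 0 < C₀ := hc₀.trans_le hcC
  refine ⟨√(δ / (4 * C₀)), by positivity, 1, one_pos, ?_⟩
  intro t α a b lam ht _ hα _ _ ha hdisc hroot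
  rcases ht.eq_or_lt with rfl | ht
  · simp
  rw [depressed_cubic_discrim_eq hroot] at hdisc
  have hs : 0 < t + α := by linarith
  have hle : δ * t ^ 2 * (t + α) ≤ (3 * lam ^ 2 - a) ^ 2 * (4 * C₀) * (t + α) :=
    calc δ * t ^ 2 * (t + α) ≤ (3 * lam ^ 2 - a) ^ 2 * (4 * a - 3 * lam ^ 2) := hdisc
      _ ≤ (3 * lam ^ 2 - a) ^ 2 * (4 * (C₀ * (t + α))) := by
        gcongr
        nlinarith [sq_nonneg lam]
      _ = _ := by ring
  refine abs_le_of_sq_le_sq' ?_ (abs_nonneg _) |>.2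
  rw [sq_abs, mul_pow, Real.sq_sqrt (by positivity), div_mul_eq_mul_div, div_le_iff₀ (by positivity)]
  exact le_of_mul_le_mul_right hle hs
end

section
/- For all constants c₀, C₀, δ with 0 < c₀ ≤ C₀ and δ > 0, there exist c₁ > 0 and T > 0 such that: for all real t, α with 0 ≤ t ≤ T and 0 ≤ α ≤ T, and all real a, b satisfying c₀(t+α) ≤ a ≤ C₀(t+α) and 4a³ − 27b² ≥ δ t(t+α)², every real root λ of the cubic equation λ³ − aλ + b = 0 satisfies |3λ² − a| ≥ c₁ √(t(t+α)). -/
/-- At a root `x` of `τ³ - aτ + b`, the discriminant is the squared derivative times `4a - 3x²`. -/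
theorem cubic_discrim_eq_of_root {a b x : ℝ} (h : x ^ 3 - a * x + b = 0) :
    4 * a ^ 3 - 27 * b ^ 2 = (3 * x ^ 2 - a) ^ 2 * (4 * a - 3 * x ^ 2) := by
  obtain rfl : b = a * x - x ^ 3 := by linarith
  ring

/-- Proposition 2.3 (second part): under condition (E), |∂_τ p| ≥ c₁ √(t(t+α)) at every real root. -/
theorem stmt_5 (c₀ C₀ δ : ℝ) (hc₀ : 0 < c₀) (hcC : c₀ ≤ C₀) (hδ : 0 < δ) :
    ∃ c₁ : ℝ, 0 < c₁ ∧ ∃ T : ℝ, 0 < T ∧ ∀ t α a b lam : ℝ,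
      0 ≤ t → t ≤ T → 0 ≤ α → α ≤ T →
      c₀ * (t + α) ≤ a → a ≤ C₀ * (t + α) →
      4 * a ^ 3 - 27 * b ^ 2 ≥ δ * t * (t + α) ^ 2 →
      lam ^ 3 - a * lam + b = 0 →
      |3 * lam ^ 2 - a| ≥ c₁ * Real.sqrt (t * (t + α)) := by
  have hC₀ : 0 < C₀ := hc₀.trans_le hcC
  refine ⟨Real.sqrt (δ / (4 * C₀)), by positivity, 1, one_pos, ?_⟩
  intro t α a b lam ht _ hα _ _ ha hE hroot
  rw [ge_iff_le, ← Real.sqrt_mul (by positivity), ← Real.sqrt_sq_eq_abs]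
  apply Real.sqrt_le_sqrt
  rcases (add_nonneg ht hα).eq_or_lt with hs | hs
  · rw [← hs, mul_zero, mul_zero]
    positivity
  · rw [cubic_discrim_eq_of_root hroot] at hE
    have hfactor : (3 * lam ^ 2 - a) ^ 2 * (4 * a - 3 * lam ^ 2) ≤
        (3 * lam ^ 2 - a) ^ 2 * (4 * C₀ * (t + α)) :=
      mul_le_mul_of_nonneg_left (by nlinarith [sq_nonneg lam]) (sq_nonneg _)
    rw [div_mul_eq_mul_div, div_le_iff₀ (by positivity)]
    refine le_of_mul_le_mul_right ?_ hs
    linarith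
end

section
/- For all constants c₀, C₀, δ with 0 < c₀ ≤ C₀ and δ > 0, there exist c₁ > 0 and T > 0 such that: for all real t, α with 0 < t ≤ T and 0 ≤ α ≤ T, and all real a, b satisfying c₀(t+α) ≤ a ≤ C₀(t+α) and 4a³ − 27b² ≥ δ t(t+α)², the cubic λ³ − aλ + b has three distinct real roots, and any two distinct real roots μ ≠ ν satisfy |μ − ν| ≥ c₁ √t. -/
/-- A depressed cubic with positive discriminant has three distinct real roots. -/
theorem exists_three_roots_of_discr_pos {a b : ℝ} (ha : 0 < a) (h : 0 < 4 * a ^ 3 - 27 * b ^ 2) :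
    ∃ r₁ r₂ r₃ : ℝ, r₁ < r₂ ∧ r₂ < r₃ ∧
      r₁ ^ 3 - a * r₁ + b = 0 ∧ r₂ ^ 3 - a * r₂ + b = 0 ∧ r₃ ^ 3 - a * r₃ + b = 0 := by
  obtain ⟨s, hs, rfl⟩ : ∃ s : ℝ, 0 < s ∧ a = 3 * s ^ 2 :=
    ⟨√(a / 3), by positivity, by rw [Real.sq_sqrt (by positivity)]; ring⟩
  have hb : |b| < 2 * s ^ 3 := abs_lt_of_sq_lt_sq (by nlinarith) (by positivity)
  obtain ⟨hb₁, hb₂⟩ := abs_lt.mp hb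
  have hc (u v : ℝ) : ContinuousOn (fun x : ℝ => x ^ 3 - 3 * s ^ 2 * x + b) (Set.Icc u v) := by
    fun_prop
  obtain ⟨x, hx, hx₀⟩ := intermediate_value_Ioo (by linarith : -(2 * s) ≤ -s) (hc _ _)
    (show (0 : ℝ) ∈ Set.Ioo _ _ from ⟨by ring_nf; linarith, by ring_nf; linarith⟩)
  obtain ⟨y, hy, hy₀⟩ := intermediate_value_Ioo' (by linarith : -s ≤ s) (hc _ _)
    (show (0 : ℝ) ∈ Set.Ioo _ _ from ⟨by ring_nf; linarith, by ring_nf; linarith⟩)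
  obtain ⟨z, hz, hz₀⟩ := intermediate_value_Ioo (by linarith : s ≤ 2 * s) (hc _ _)
    (show (0 : ℝ) ∈ Set.Ioo _ _ from ⟨by ring_nf; linarith, by ring_nf; linarith⟩)
  exact ⟨x, y, z, hx.2.trans hy.1, hy.2.trans hz.1, hx₀, hy₀, hz₀⟩

/-- The discriminant of a depressed cubic is controlled by the gap between any two distinct roots. -/
theorem discr_le_mul_sq_sub_of_roots {a b μ ν : ℝ} (hμ : μ ^ 3 - a * μ + b = 0)
    (hν : ν ^ 3 - a * ν + b = 0) (h : μ ≠ ν) :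
    4 * a ^ 3 - 27 * b ^ 2 ≤ 16 * a ^ 2 * (μ - ν) ^ 2 := by
  obtain rfl : a = μ ^ 2 + μ * ν + ν ^ 2 :=
    mul_left_cancel₀ (sub_ne_zero.mpr h) (by linear_combination hν - hμ)
  obtain rfl : b = μ * ν * (μ + ν) := by linear_combination hμ
  set a := μ ^ 2 + μ * ν + ν ^ 2 with ha
  have hle : (2 * μ + ν) ^ 2 * (μ + 2 * ν) ^ 2 ≤ (4 * a) * (4 * a) := by
    gcongr
    · nlinarith [sq_nonneg (μ + ν), sq_nonneg μ, sq_nonneg ν]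
    · nlinarith [sq_nonneg ν]
    · nlinarith [sq_nonneg μ]
  calc 4 * a ^ 3 - 27 * (μ * ν * (μ + ν)) ^ 2
      = (2 * μ + ν) ^ 2 * (μ + 2 * ν) ^ 2 * (μ - ν) ^ 2 := by rw [ha]; ring
    _ ≤ (4 * a) * (4 * a) * (μ - ν) ^ 2 := by gcongr
    _ = 16 * a ^ 2 * (μ - ν) ^ 2 := by ring


/-- Root separation under condition (E): three distinct real roots, pairwise at distance ≥ c₁√t. -/
theorem stmt_6 (c₀ C₀ δ : ℝ) (hc₀ : 0 < c₀) (hcC : c₀ ≤ C₀) (hδ : 0 < δ) :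
    ∃ c₁ : ℝ, 0 < c₁ ∧ ∃ T : ℝ, 0 < T ∧ ∀ t α a b : ℝ,
      0 < t → t ≤ T → 0 ≤ α → α ≤ T →
      c₀ * (t + α) ≤ a → a ≤ C₀ * (t + α) →
      4 * a ^ 3 - 27 * b ^ 2 ≥ δ * t * (t + α) ^ 2 →
      ((∃ r₁ r₂ r₃ : ℝ, r₁ ≠ r₂ ∧ r₁ ≠ r₃ ∧ r₂ ≠ r₃ ∧
          r₁ ^ 3 - a * r₁ + b = 0 ∧ r₂ ^ 3 - a * r₂ + b = 0 ∧ r₃ ^ 3 - a * r₃ + b = 0) ∧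
        ∀ μ ν : ℝ, μ ^ 3 - a * μ + b = 0 → ν ^ 3 - a * ν + b = 0 → μ ≠ ν →
          |μ - ν| ≥ c₁ * Real.sqrt t) := by
  have hC₀ : 0 < C₀ := hc₀.trans_le hcC
  refine ⟨√δ / (4 * C₀), by positivity, 1, one_pos, ?_⟩
  intro t α a b ht _ hα _ ha₁ ha₂ hΔ
  have hs : 0 < t + α := by linarith
  have ha : 0 < a := (mul_pos hc₀ hs).trans_le ha₁
  have hΔ₀ : 0 < 4 * a ^ 3 - 27 * b ^ 2 := lt_of_lt_of_le (by positivity) hΔ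
  refine ⟨?_, fun μ ν hμ hν hne => ?_⟩
  · obtain ⟨x, y, z, hxy, hyz, h⟩ := exists_three_roots_of_discr_pos ha hΔ₀
    exact ⟨x, y, z, hxy.ne, (hxy.trans hyz).ne, hyz.ne, h⟩
  · have hle : δ * t * (t + α) ^ 2 ≤ 16 * C₀ ^ 2 * (μ - ν) ^ 2 * (t + α) ^ 2 :=
      calc δ * t * (t + α) ^ 2 ≤ 16 * a ^ 2 * (μ - ν) ^ 2 :=
            hΔ.le.trans (discr_le_mul_sq_sub_of_roots hμ hν hne)
        _ ≤ 16 * (C₀ * (t + α)) ^ 2 * (μ - ν) ^ 2 := by gcongr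
        _ = 16 * C₀ ^ 2 * (μ - ν) ^ 2 * (t + α) ^ 2 := by ring
    have hgap : δ * t ≤ 16 * C₀ ^ 2 * (μ - ν) ^ 2 := le_of_mul_le_mul_right hle (by positivity)
    refine (le_abs_self _).trans (sq_le_sq.mp ?_)
    rw [mul_pow, div_pow, Real.sq_sqrt hδ.le, Real.sq_sqrt ht.le, div_mul_eq_mul_div,
      div_le_iff₀ (by positivity)]
    linarith
end

section
/- Let d be a positive integer and let g, h : ℝ^d → ℝ be three-times continuously differentiable functions all of whose derivatives up to order 3 are bounded on ℝ^d. Suppose g(x) ≥ 0 for all x and there is a constant C > 0 with |h(x)| ≤ C·g(x)^{3/2} for all x ∈ ℝ^d. Then there exists a constant C' > 0 such that |∇h(x)| ≤ C'·g(x) for all x ∈ ℝ^d. -/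
section SymmetricDifferences

variable {E F : Type*} [NormedAddCommGroup E] [NormedSpace ℝ E]
  [NormedAddCommGroup F] [NormedSpace ℝ F]

/-- The second symmetric difference of a function with bounded second derivative. -/
lemma norm_add_add_sub_sub_two_smul_le {f : E → F} {M : ℝ} (hf : ContDiff ℝ 2 f)
    (hM : ∀ x, ‖iteratedFDeriv ℝ 2 f x‖ ≤ M) (x v : E) :
    ‖f (x + v) + f (x - v) - (2 : ℝ) • f x‖ ≤ 2 * M * ‖v‖ ^ 2 := by
  have hM0 : 0 ≤ M := (norm_nonneg _).trans (hM x)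
  have hd : Differentiable ℝ f := hf.differentiable (by norm_num)
  have hdd : Differentiable ℝ (fderiv ℝ f) :=
    (hf.fderiv_right (m := 1) (by norm_num)).differentiable (by norm_num)
  have hlip (y z : E) : ‖fderiv ℝ f y - fderiv ℝ f z‖ ≤ M * ‖y - z‖ :=
    convex_univ.norm_image_sub_le_of_norm_fderiv_le (fun w _ ↦ hdd w)
      (fun w _ ↦ by rw [← norm_iteratedFDeriv_one, norm_iteratedFDeriv_fderiv]; exact hM w)
      (Set.mem_univ z) (Set.mem_univ y)
  have hderiv (w : E) : HasFDerivAt (fun w ↦ f (x + w) + f (x - w))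
      (fderiv ℝ f (x + w) - fderiv ℝ f (x - w)) w := by
    have h₁ := (hd (x + w)).hasFDerivAt.comp w ((hasFDerivAt_id w).const_add x)
    have h₂ := (hd (x - w)).hasFDerivAt.comp w ((hasFDerivAt_id w).const_sub x)
    refine (h₁.add h₂).congr_fderiv ?_
    ext u
    simp [sub_eq_add_neg]
  have key := (convex_closedBall (0 : E) ‖v‖).norm_image_sub_le_of_norm_hasFDerivWithin_le
    (fun w _ ↦ (hderiv w).hasFDerivWithinAt) (C := 2 * M * ‖v‖) (x := 0) (y := v)
    (fun w hw ↦ by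
      refine (hlip _ _).trans ?_
      have hw' : ‖w‖ ≤ ‖v‖ := by simpa using hw
      have : ‖x + w - (x - w)‖ ≤ 2 * ‖w‖ := by
        rw [add_sub_sub_cancel, two_mul]
        exact norm_add_le w w
      nlinarith)
    (by simp) (by simp)
  simp only [add_zero, sub_zero, ← two_smul ℝ (f x)] at key
  exact key.trans_eq (by ring)

/-- The first symmetric difference of a function with bounded third derivative. -/
lemma norm_add_sub_sub_sub_two_smul_fderiv_le {f : E → F} {M : ℝ} (hf : ContDiff ℝ 3 f)
    (hM : ∀ x, ‖iteratedFDeriv ℝ 3 f x‖ ≤ M) (x v : E) :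
    ‖f (x + v) - f (x - v) - (2 : ℝ) • fderiv ℝ f x v‖ ≤ 2 * M * ‖v‖ ^ 3 := by
  have hM0 : 0 ≤ M := (norm_nonneg _).trans (hM x)
  have hd : Differentiable ℝ f := hf.differentiable (by norm_num)
  have hsecond := norm_add_add_sub_sub_two_smul_le (hf.fderiv_right (m := 2) (by norm_num))
    (fun y ↦ by rw [norm_iteratedFDeriv_fderiv]; exact hM y) x
  have hderiv (w : E) :
      HasFDerivAt (fun w ↦ f (x + w) - f (x - w) - (2 : ℝ) • fderiv ℝ f x w)
        (fderiv ℝ f (x + w) + fderiv ℝ f (x - w) - (2 : ℝ) • fderiv ℝ f x) w := by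
    have h₁ := (hd (x + w)).hasFDerivAt.comp w ((hasFDerivAt_id w).const_add x)
    have h₂ := (hd (x - w)).hasFDerivAt.comp w ((hasFDerivAt_id w).const_sub x)
    refine ((h₁.sub h₂).sub ((fderiv ℝ f x).hasFDerivAt.const_smul (2 : ℝ))).congr_fderiv ?_
    ext u
    simp
  have key := (convex_closedBall (0 : E) ‖v‖).norm_image_sub_le_of_norm_hasFDerivWithin_le
    (fun w _ ↦ (hderiv w).hasFDerivWithinAt) (C := 2 * M * ‖v‖ ^ 2) (x := 0) (y := v)
    (fun w hw ↦ by
      have hw' : ‖w‖ ≤ ‖v‖ := by simpa using hw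
      exact (hsecond w).trans (by gcongr))
    (by simp) (by simp)
  simp only [add_zero, sub_zero, map_zero, smul_zero, sub_self] at key
  exact key.trans_eq (by ring)

/-- If `|h| ≤ C g ^ (3 / 2)` with `g` nonnegative, then the derivative of `h` is `O(g)`. -/
lemma norm_fderiv_le_of_abs_le_rpow {g h : E → ℝ} {A B C : ℝ}
    (hg : ContDiff ℝ 2 g) (hh : ContDiff ℝ 3 h)
    (hA : ∀ x, ‖iteratedFDeriv ℝ 2 g x‖ ≤ A) (hB : ∀ x, ‖iteratedFDeriv ℝ 3 h x‖ ≤ B)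
    (hg0 : ∀ x, 0 ≤ g x) (hC : 0 ≤ C) (hhg : ∀ x, |h x| ≤ C * g x ^ ((3 : ℝ) / 2)) (x : E) :
    ‖fderiv ℝ h x‖ ≤ (C * (2 + 2 * A) ^ ((3 : ℝ) / 2) + B) * g x := by
  have hA0 : 0 ≤ A := (norm_nonneg _).trans (hA x)
  have hB0 : 0 ≤ B := (norm_nonneg _).trans (hB x)
  set L := 2 + 2 * A
  set K := C * L ^ ((3 : ℝ) / 2) + B
  have hL0 : 0 ≤ L := by positivity
  have hK0 : 0 ≤ K := by positivity
  have key (t : ℝ) (ht : 0 < t) (hgt : g x ≤ t ^ 2) : ‖fderiv ℝ h x‖ ≤ K * t ^ 2 := by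
    refine ContinuousLinearMap.opNorm_le_of_unit_norm (by positivity) fun u hu ↦ ?_
    have hv : ‖t • u‖ = t := by rw [norm_smul, hu, mul_one, Real.norm_of_nonneg ht.le]
    have hsum := norm_add_add_sub_sub_two_smul_le hg hA x (t • u)
    have hdiff := norm_add_sub_sub_sub_two_smul_fderiv_le hh hB x (t • u)
    rw [hv, Real.norm_eq_abs, smul_eq_mul, abs_le] at hsum hdiff
    have hbound (y : E) (hy : g y ≤ L * t ^ 2) : |h y| ≤ C * L ^ ((3 : ℝ) / 2) * t ^ 3 := by
      have hpow : (t ^ 2) ^ ((3 : ℝ) / 2) = t ^ 3 := by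
        rw [← Real.rpow_natCast_mul ht.le, ← Real.rpow_natCast]
        norm_num
      calc |h y| ≤ C * g y ^ ((3 : ℝ) / 2) := hhg y
        _ ≤ C * (L * t ^ 2) ^ ((3 : ℝ) / 2) := by
          gcongr
          exact hg0 y
        _ = C * L ^ ((3 : ℝ) / 2) * t ^ 3 := by
          rw [Real.mul_rpow hL0 (by positivity), hpow, mul_assoc]
    have hp := abs_le.1 <| hbound (x + t • u) (by linarith [hg0 (x - t • u)])
    have hm := abs_le.1 <| hbound (x - t • u) (by linarith [hg0 (x + t • u)])
    rw [map_smul, smul_eq_mul] at hdiff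
    have : |t * fderiv ℝ h x u| ≤ t * (K * t ^ 2) := by
      have : t * (K * t ^ 2) = C * L ^ ((3 : ℝ) / 2) * t ^ 3 + B * t ^ 3 := by ring
      rw [this, abs_le]
      constructor <;> linarith
    rw [abs_mul, abs_of_pos ht] at this
    exact le_of_mul_le_mul_left this ht
  have hlim : Filter.Tendsto (fun ε : ℝ ↦ K * (g x + ε)) (nhdsWithin 0 (Set.Ioi 0))
      (nhds (K * g x)) := by
    have : Continuous fun ε : ℝ ↦ K * (g x + ε) := by fun_prop
    simpa using (this.tendsto 0).mono_left nhdsWithin_le_nhds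
  refine ge_of_tendsto hlim (eventually_nhdsWithin_of_forall fun ε (hε : 0 < ε) ↦ ?_)
  have hpos : 0 < g x + ε := add_pos_of_nonneg_of_pos (hg0 x) hε
  have := key √(g x + ε) (Real.sqrt_pos.2 hpos)
  rw [Real.sq_sqrt hpos.le] at this
  exact this (by linarith)

end SymmetricDifferences

/-- Lemma 3.2, eq. (2.5): |h| ≤ C g^{3/2} with g ≥ 0 forces |∇h| = O(g). -/
theorem stmt_7 (d : ℕ) (hd : 0 < d)
    (g h : EuclideanSpace ℝ (Fin d) → ℝ)
    (hg : ContDiff ℝ 3 g) (hh : ContDiff ℝ 3 h)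
    (hgbd : ∀ i : ℕ, i ≤ 3 → ∃ C : ℝ, ∀ x, ‖iteratedFDeriv ℝ i g x‖ ≤ C)
    (hhbd : ∀ i : ℕ, i ≤ 3 → ∃ C : ℝ, ∀ x, ‖iteratedFDeriv ℝ i h x‖ ≤ C)
    (hgnn : ∀ x, 0 ≤ g x)
    (C : ℝ) (hC : 0 < C) (hhg : ∀ x, |h x| ≤ C * g x ^ ((3 : ℝ) / 2)) :
    ∃ C' : ℝ, 0 < C' ∧ ∀ x, ‖gradient h x‖ ≤ C' * g x := by
  obtain ⟨A, hA⟩ := hgbd 2 (by norm_num)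
  obtain ⟨B, hB⟩ := hhbd 3 le_rfl
  have hA0 : 0 ≤ A := (norm_nonneg _).trans (hA 0)
  have hB0 : 0 ≤ B := (norm_nonneg _).trans (hB 0)
  refine ⟨C * (2 + 2 * A) ^ ((3 : ℝ) / 2) + B, by positivity, fun x ↦ ?_⟩
  rw [gradient, LinearIsometryEquiv.norm_map]
  exact norm_fderiv_le_of_abs_le_rpow (hg.of_le (by norm_num)) hh hA hB hgnn hC.le hhg x
end

section
/- Let d be a positive integer and let g, h : ℝ^d → ℝ be three-times continuously differentiable functions all of whose derivatives up to order 3 are bounded on ℝ^d. Suppose g(x) ≥ 0 for all x and there is a constant C > 0 with |h(x)| ≤ C·g(x)^{3/2} for all x ∈ ℝ^d. Then there exists a constant C' > 0 such that for all x ∈ ℝ^d and all X ∈ ℝ^d one has |⟨D²h(x) X, X⟩| ≤ C'·√(g(x))·|X|², where D²h(x) is the Hessian of h at x. -/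
open scoped Nat in
/-- Taylor's formula in several variables, with remainder bounded through a uniform bound on the
next derivative. -/
theorem norm_sub_taylor_sum_le {E : Type*} [NormedAddCommGroup E] [NormedSpace ℝ E]
    {f : E → ℝ} {n : ℕ} {M : ℝ} (hf : ContDiff ℝ (n + 1 : ℕ) f)
    (hM : ∀ x, ‖iteratedFDeriv ℝ (n + 1) f x‖ ≤ M) (x y : E) :
    |f (x + y) - ∑ k ∈ Finset.range (n + 1), (k ! : ℝ)⁻¹ * iteratedFDeriv ℝ k f x (fun _ ↦ y)|
      ≤ M * ‖y‖ ^ (n + 1) := by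
  have hM0 : 0 ≤ M := (norm_nonneg _).trans (hM x)
  have hint : ‖∫ t in (0 : ℝ)..1, (1 - t) ^ n • iteratedFDeriv ℝ (n + 1) f (x + t • y) (fun _ ↦ y)‖
      ≤ M * ‖y‖ ^ (n + 1) * |1 - 0| := by
    refine intervalIntegral.norm_integral_le_of_norm_le_const fun t ht ↦ ?_
    rw [Set.uIoc_of_le zero_le_one] at ht
    rw [norm_smul, norm_pow]
    have h1 : ‖1 - t‖ ^ n ≤ 1 := by
      refine pow_le_one₀ (norm_nonneg _) ?_
      rw [Real.norm_eq_abs, abs_le]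
      constructor <;> linarith [ht.1, ht.2]
    have h2 : ‖iteratedFDeriv ℝ (n + 1) f (x + t • y) (fun _ ↦ y)‖ ≤ M * ‖y‖ ^ (n + 1) := by
      refine (ContinuousMultilinearMap.le_opNorm _ _).trans ?_
      simpa using mul_le_mul_of_nonneg_right (hM (x + t • y)) (pow_nonneg (norm_nonneg y) (n + 1))
    simpa using mul_le_mul h1 h2 (norm_nonneg _) zero_le_one
  have htaylor := map_add_eq_sum_add_integral_iteratedFDeriv (f := f) (x := x) (y := y) (n := n)
    (fun t _ ↦ hf.contDiffAt)
  simp only [smul_eq_mul] at htaylor hint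
  rw [htaylor, add_sub_cancel_left, abs_mul]
  have hfac : |(n ! : ℝ)⁻¹| ≤ 1 := by
    rw [abs_of_nonneg (by positivity)]
    exact inv_le_one_of_one_le₀ (mod_cast Nat.one_le_iff_ne_zero.2 n.factorial_ne_zero)
  rw [sub_zero, abs_one, mul_one, Real.norm_eq_abs] at hint
  simpa using mul_le_mul hfac hint (abs_nonneg _) zero_le_one

/-- A nonnegative function with bounded second derivative is at most a multiple of `‖y‖ ^ 2` at
`x + y` as soon as `√(g x) ≤ ‖y‖`. -/
theorem le_mul_norm_sq_of_sqrt_le {E : Type*} [NormedAddCommGroup E] [NormedSpace ℝ E]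
    {g : E → ℝ} {M : ℝ} (hg : ContDiff ℝ 2 g) (hM : ∀ x, ‖iteratedFDeriv ℝ 2 g x‖ ≤ M)
    (hg0 : ∀ x, 0 ≤ g x) {x y : E} (hxy : √(g x) ≤ ‖y‖) :
    g (x + y) ≤ (2 + 2 * M) * ‖y‖ ^ 2 := by
  have hx : g x ≤ ‖y‖ ^ 2 := (Real.sqrt_le_left (norm_nonneg y)).1 hxy
  have h1 := norm_sub_taylor_sum_le (n := 1) hg hM x y
  have h2 := norm_sub_taylor_sum_le (n := 1) hg hM x (-y)
  simp only [Finset.sum_range_succ, Finset.sum_range_zero, Nat.factorial,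
    iteratedFDeriv_zero_apply, iteratedFDeriv_one_apply, map_neg, norm_neg] at h1 h2
  norm_num at h1 h2
  rw [abs_le] at h1 h2
  linarith [hg0 (x + -y), h1.2, h2.2]

/-- The second derivative is controlled by the symmetric second difference and a bound on the third
derivative. -/
theorem abs_iteratedFDeriv_two_le {E : Type*} [NormedAddCommGroup E] [NormedSpace ℝ E]
    {h : E → ℝ} {N : ℝ} (hh : ContDiff ℝ 3 h) (hN : ∀ x, ‖iteratedFDeriv ℝ 3 h x‖ ≤ N)
    (x y : E) :
    |iteratedFDeriv ℝ 2 h x ![y, y]|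
      ≤ |h (x + y)| + |h (x + -y)| + 2 * |h x| + 2 * N * ‖y‖ ^ 3 := by
  have h1 := norm_sub_taylor_sum_le (n := 2) hh hN x y
  have h2 := norm_sub_taylor_sum_le (n := 2) hh hN x (-y)
  have e1 : (fun _ ↦ y : Fin 2 → E) = ![y, y] := by ext i; fin_cases i <;> rfl
  have e2 : iteratedFDeriv ℝ 2 h x (fun _ ↦ -y) = iteratedFDeriv ℝ 2 h x ![y, y] := by
    rw [← e1]
    simpa using (iteratedFDeriv ℝ 2 h x).map_smul_univ (fun _ ↦ (-1 : ℝ)) (fun _ ↦ y)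
  simp only [Finset.sum_range_succ, Finset.sum_range_zero, Nat.factorial, e1, e2,
    iteratedFDeriv_zero_apply, iteratedFDeriv_one_apply, map_neg, norm_neg] at h1 h2
  norm_num at h1 h2
  rw [abs_le] at h1 h2
  rw [abs_le]
  constructor <;>
  linarith [neg_abs_le (h (x + y)), le_abs_self (h (x + y)), neg_abs_le (h (x + -y)),
    le_abs_self (h (x + -y)), neg_abs_le (h x), le_abs_self (h x), h1.1, h1.2, h2.1, h2.2]

/-- Lemma 3.2, eq. (2.6): |h| ≤ C g^{3/2} with g ≥ 0 forces |⟨D²h X, X⟩| = O(√g |X|²). -/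
theorem stmt_8 (d : ℕ) (hd : 0 < d)
    (g h : EuclideanSpace ℝ (Fin d) → ℝ)
    (hg : ContDiff ℝ 3 g) (hh : ContDiff ℝ 3 h)
    (hgbd : ∀ i : ℕ, i ≤ 3 → ∃ C : ℝ, ∀ x, ‖iteratedFDeriv ℝ i g x‖ ≤ C)
    (hhbd : ∀ i : ℕ, i ≤ 3 → ∃ C : ℝ, ∀ x, ‖iteratedFDeriv ℝ i h x‖ ≤ C)
    (hgnn : ∀ x, 0 ≤ g x)
    (C : ℝ) (hC : 0 < C) (hhg : ∀ x, |h x| ≤ C * g x ^ ((3 : ℝ) / 2)) :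
    ∃ C' : ℝ, 0 < C' ∧ ∀ x X, |iteratedFDeriv ℝ 2 h x ![X, X]|
      ≤ C' * Real.sqrt (g x) * ‖X‖ ^ 2 := by
  obtain ⟨M, hM⟩ := hgbd 2 (by norm_num)
  obtain ⟨N, hN⟩ := hhbd 3 le_rfl
  have hM0 : 0 ≤ M := (norm_nonneg _).trans (hM 0)
  have hN0 : 0 ≤ N := (norm_nonneg _).trans (hN 0)
  have hg2 : ContDiff ℝ 2 g := hg.of_le (by norm_num)
  set A : ℝ := C * (2 + 2 * M) ^ ((3 : ℝ) / 2) with hA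
  have hA0 : 0 < A := by positivity
  have hbound {z : EuclideanSpace ℝ (Fin d)} {t : ℝ} (ht : 0 ≤ t)
      (hz : g z ≤ (2 + 2 * M) * t ^ 2) : |h z| ≤ A * t ^ 3 := by
    have hpow : (t ^ 2) ^ ((3 : ℝ) / 2) = t ^ 3 := by
      rw [← Real.rpow_natCast t 2, ← Real.rpow_mul ht, ← Real.rpow_natCast t 3]
      norm_num
    calc |h z| ≤ C * g z ^ ((3 : ℝ) / 2) := hhg z
      _ ≤ C * ((2 + 2 * M) * t ^ 2) ^ ((3 : ℝ) / 2) := by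
        gcongr
        exact hgnn z
      _ = A * t ^ 3 := by
        rw [Real.mul_rpow (by positivity) (by positivity), hpow, hA, mul_assoc]
  refine ⟨4 * A + 2 * N, by positivity, fun x X ↦ ?_⟩
  have hlarge (y : EuclideanSpace ℝ (Fin d)) (hy : √(g x) ≤ ‖y‖) :
      |iteratedFDeriv ℝ 2 h x ![y, y]| ≤ (4 * A + 2 * N) * ‖y‖ ^ 3 := by
    have h0 : |h x| ≤ A * ‖y‖ ^ 3 := by
      refine hbound (norm_nonneg y) ?_
      nlinarith [(Real.sqrt_le_left (norm_nonneg y)).1 hy, sq_nonneg ‖y‖]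
    have h1 := hbound (norm_nonneg y) (le_mul_norm_sq_of_sqrt_le hg2 hM hgnn hy)
    have h2 := hbound (norm_nonneg (-y))
      (le_mul_norm_sq_of_sqrt_le (y := -y) hg2 hM hgnn (by rwa [norm_neg]))
    rw [norm_neg] at h2
    linarith [abs_iteratedFDeriv_two_le hh hN x y]
  rcases eq_or_ne X 0 with rfl | hX
  · rw [(iteratedFDeriv ℝ 2 h x).map_coord_zero 0 (by simp)]
    simp
  have hXpos : 0 < ‖X‖ := norm_pos_iff.2 hX
  have hscaled : ∀ t, √(g x) < t →
      |iteratedFDeriv ℝ 2 h x ![X, X]| / ((4 * A + 2 * N) * ‖X‖ ^ 2) ≤ t := by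
    intro t ht
    have ht0 : 0 < t := (Real.sqrt_nonneg _).trans_lt ht
    have hnorm : ‖(t / ‖X‖) • X‖ = t := by
      rw [norm_smul, Real.norm_of_nonneg (by positivity), div_mul_cancel₀ _ hXpos.ne']
    have hsmul : iteratedFDeriv ℝ 2 h x ![(t / ‖X‖) • X, (t / ‖X‖) • X]
        = (t / ‖X‖) ^ 2 * iteratedFDeriv ℝ 2 h x ![X, X] := by
      have := (iteratedFDeriv ℝ 2 h x).map_smul_univ (fun _ ↦ t / ‖X‖) ![X, X]
      rw [Fin.prod_const, smul_eq_mul] at this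
      rw [← this]
      congr 1
      ext i
      fin_cases i <;> rfl
    have hmain := hlarge ((t / ‖X‖) • X) (by rw [hnorm]; exact ht.le)
    rw [hnorm, hsmul, abs_mul, abs_of_nonneg (by positivity), div_pow, div_mul_eq_mul_div,
      div_le_iff₀ (by positivity)] at hmain
    rw [div_le_iff₀ (by positivity)]
    refine le_of_mul_le_mul_left ?_ (pow_pos ht0 2)
    linarith
  have := le_of_forall_gt_imp_ge_of_dense hscaled
  rw [div_le_iff₀ (by positivity)] at this
  linarith
end

section
/- Let M, C, T > 0. There exists C' > 0 such that: for every α with 0 ≤ α ≤ T, all real β₀, β₁, and every function β₂ : [0,T] → ℝ with |β₂(t)| ≤ M for all t ∈ [0,T], if (β₀ + t β₁ + t² β₂(t))² ≤ C (t+α)³ for all t ∈ [0,T], then |β₁| ≤ C' √α. -/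
/-- Evaluating the growth hypothesis at `0` and `r ^ 2`, for a scale `r` with `α ≤ r ^ 2 ≤ T`,
bounds the linear coefficient by a multiple of `r`. -/
theorem abs_linear_coeff_le {M C T α β₀ β₁ r : ℝ} {β₂ : ℝ → ℝ} (hM : 0 < M) (hC : 0 < C)
    (hT : 0 < T) (hα : 0 ≤ α)
    (hβ : ∀ t, 0 ≤ t → t ≤ T → |β₂ t| ≤ M)
    (h : ∀ t, 0 ≤ t → t ≤ T → (β₀ + t * β₁ + t ^ 2 * β₂ t) ^ 2 ≤ C * (t + α) ^ 3)
    (hr : 0 < r) (hαr : α ≤ r ^ 2) (hrT : r ^ 2 ≤ T) :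
    |β₁| ≤ (4 * Real.sqrt C + Real.sqrt T * M) * r := by
  have hD : Real.sqrt C ^ 2 = C := Real.sq_sqrt hC.le
  have hD0 : 0 ≤ Real.sqrt C := Real.sqrt_nonneg C
  have hrS : r ≤ Real.sqrt T := Real.le_sqrt_of_sq_le hrT
  have h0 : |β₀| ≤ Real.sqrt C * r ^ 3 := by
    apply abs_le_of_sq_le_sq _ (by positivity)
    calc β₀ ^ 2 ≤ C * α ^ 3 := by simpa using h 0 le_rfl hT.le
      _ ≤ C * (r ^ 2) ^ 3 := by gcongr
      _ = (Real.sqrt C * r ^ 3) ^ 2 := by rw [mul_pow, hD]; ring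
  have h1 : |β₀ + r ^ 2 * β₁ + (r ^ 2) ^ 2 * β₂ (r ^ 2)| ≤ 3 * Real.sqrt C * r ^ 3 := by
    apply abs_le_of_sq_le_sq _ (by positivity)
    calc (β₀ + r ^ 2 * β₁ + (r ^ 2) ^ 2 * β₂ (r ^ 2)) ^ 2
        ≤ C * (r ^ 2 + α) ^ 3 := h _ (by positivity) hrT
      _ ≤ C * (r ^ 2 + r ^ 2) ^ 3 := by gcongr
      _ ≤ 9 * C * r ^ 6 := by nlinarith [show 0 ≤ C * r ^ 6 by positivity]
      _ = (3 * Real.sqrt C * r ^ 3) ^ 2 := by rw [mul_pow, mul_pow, hD]; ring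
  have h2 : |r ^ 4 * β₂ (r ^ 2)| ≤ r ^ 3 * (Real.sqrt T * M) := by
    rw [abs_mul, abs_of_pos (by positivity : 0 < r ^ 4)]
    calc r ^ 4 * |β₂ (r ^ 2)| ≤ r ^ 4 * M := by
          gcongr
          exact hβ _ (by positivity) hrT
      _ = r ^ 3 * (r * M) := by ring
      _ ≤ r ^ 3 * (Real.sqrt T * M) := by gcongr
  have h3 : r ^ 2 * |β₁| ≤ r ^ 2 * ((4 * Real.sqrt C + Real.sqrt T * M) * r) := by
    rw [← abs_of_pos (by positivity : 0 < r ^ 2), ← abs_mul,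
      abs_of_pos (by positivity : 0 < r ^ 2)]
    rw [abs_le] at h0 h1 h2 ⊢
    constructor <;> linarith
  exact le_of_mul_le_mul_left h3 (by positivity)

/-- Eq. (2.8) in Lemma 3.2: the time derivative β₁ = ∂_t b(0) is O(√α). -/
theorem stmt_9 (M C T : ℝ) (hM : 0 < M) (hC : 0 < C) (hT : 0 < T) :
    ∃ C' : ℝ, 0 < C' ∧ ∀ α : ℝ, 0 ≤ α → α ≤ T → ∀ β₀ β₁ : ℝ, ∀ β₂ : ℝ → ℝ,
      (∀ t, 0 ≤ t → t ≤ T → |β₂ t| ≤ M) →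
      (∀ t, 0 ≤ t → t ≤ T → (β₀ + t * β₁ + t ^ 2 * β₂ t) ^ 2 ≤ C * (t + α) ^ 3) →
      |β₁| ≤ C' * Real.sqrt α := by
  have hK : 0 < 4 * Real.sqrt C + Real.sqrt T * M := by positivity
  refine ⟨4 * Real.sqrt C + Real.sqrt T * M, hK, ?_⟩
  intro α hα hαT β₀ β₁ β₂ hβ h
  rcases hα.eq_or_lt with rfl | hpos
  · rw [Real.sqrt_zero, mul_zero]
    by_contra! hne
    set K := 4 * Real.sqrt C + Real.sqrt T * M
    have hr : 0 < min (Real.sqrt T) (|β₁| / (2 * K)) :=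
      lt_min (Real.sqrt_pos.2 hT) (by positivity)
    have hrT : min (Real.sqrt T) (|β₁| / (2 * K)) ^ 2 ≤ T := by
      calc min (Real.sqrt T) (|β₁| / (2 * K)) ^ 2 ≤ Real.sqrt T ^ 2 := by
            gcongr
            exact min_le_left _ _
        _ = T := Real.sq_sqrt hT.le
    have hle : |β₁| ≤ |β₁| / 2 :=
      calc |β₁| ≤ K * min (Real.sqrt T) (|β₁| / (2 * K)) :=
            abs_linear_coeff_le hM hC hT le_rfl hβ h hr (sq_nonneg _) hrT
        _ ≤ K * (|β₁| / (2 * K)) := by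
            gcongr
            exact min_le_right _ _
        _ = |β₁| / 2 := by field_simp
    linarith
  · have hs : Real.sqrt α ^ 2 = α := Real.sq_sqrt hα
    exact abs_linear_coeff_le hM hC hT hα hβ h (Real.sqrt_pos.2 hpos) hs.ge (hs.trans_le hαT)
end

section
/- Let a, b be real numbers with a ≥ 0 and 4a³ − 27b² ≥ 0. Then the real symmetric 3×3 matrix S(a,b) with rows (3, 0, −a), (0, 2a, 3b), (−a, 3b, a²) is positive semidefinite. -/
/-- S(a,b) is positive semidefinite under the hyperbolicity conditions a ≥ 0, 4a³ - 27b² ≥ 0. -/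
theorem stmt_13 (a b : ℝ) (ha : 0 ≤ a) (hab : 0 ≤ 4 * a ^ 3 - 27 * b ^ 2) :
    (!![3, 0, -a; 0, 2*a, 3*b; -a, 3*b, a^2]).PosSemidef := by
  refine Matrix.PosSemidef.of_dotProduct_mulVec_nonneg ?_ fun v => ?_
  · ext i j
    fin_cases i <;> fin_cases j <;> simp
  · have key : 0 ≤ 2 * a * v 1 ^ 2 + 6 * b * (v 1 * v 2) + 2 / 3 * a ^ 2 * v 2 ^ 2 := by
      rcases ha.eq_or_lt with rfl | ha
      · have hb : b = 0 := by
          have : b ^ 2 = 0 := by nlinarith [sq_nonneg b]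
          simpa using this
        simp [hb]
      · refine nonneg_of_mul_nonneg_right (a := 2 * a) ?_ (by positivity)
        nlinarith [sq_nonneg (2 * a * v 1 + 3 * b * v 2), mul_nonneg hab (sq_nonneg (v 2))]
    simp [Matrix.mulVec, dotProduct, Fin.sum_univ_three]
    nlinarith [sq_nonneg (v 0 - a * v 2 / 3)]
end

section
/- For all constants c₀, C₀, δ₀, A, T₀ > 0 with c₀ ≤ C₀ there exists δ > 0 such that: for all real t, α with 0 ≤ t ≤ T₀ and 0 ≤ α ≤ A, and all real a, b satisfying c₀(t+α) ≤ a ≤ C₀(t+α) and 4a³ − 27b² ≥ δ₀ t(t+α)², the real symmetric 3×3 matrix S(a,b) − 2δt·J(a) is positive semidefinite, where S(a,b) has rows (3, 0, −a), (0, 2a, 3b), (−a, 3b, a²) and J(a) is the diagonal matrix diag(1, 1, a). -/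
/-- A ternary quadratic form without `xy` term is nonnegative if its first two diagonal
coefficients are positive and its determinant is nonnegative. -/
theorem ternary_form_nonneg {p q r a b : ℝ} (hp : 0 < p) (hq : 0 < q)
    (hdet : 0 ≤ p * q * r - a ^ 2 * q - b ^ 2 * p) (x y z : ℝ) :
    0 ≤ p * x ^ 2 + q * y ^ 2 + r * z ^ 2 - 2 * a * x * z + 2 * b * y * z := by
  refine (mul_nonneg_iff_of_pos_left (mul_pos hp hq)).1 ?_
  have h : p * q * (p * x ^ 2 + q * y ^ 2 + r * z ^ 2 - 2 * a * x * z + 2 * b * y * z) =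
      q * (p * x - a * z) ^ 2 + p * (q * y + b * z) ^ 2
        + z ^ 2 * (p * q * r - a ^ 2 * q - b ^ 2 * p) := by ring
  rw [h]
  positivity

/-- Lower bound for the determinant of the symmetrizer shifted by `s • diag(1, 1, a)`. -/
theorem symmetrizer_shift_det_ge {a b s : ℝ} (ha : 0 ≤ a) (hs : 0 ≤ s) (hs3 : s ≤ 3) :
    4 * a ^ 3 - 27 * b ^ 2 - s * (a ^ 2 * (8 + 2 * a)) ≤
      (3 - s) * (2 * a - s) * (a ^ 2 - s * a) - a ^ 2 * (2 * a - s)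
        - (3 * b) ^ 2 * (3 - s) := by
  have h : 0 ≤ 9 * s * b ^ 2 + 3 * s ^ 2 * a ^ 2 + s ^ 2 * a * (3 - s) := by
    have := sub_nonneg.2 hs3
    positivity
  linarith

/-- Lemma 3.3: under condition (E), S(a,b) ≫ 2δt·J with J = diag(1,1,a). -/
theorem stmt_14 (c₀ C₀ δ₀ A T₀ : ℝ) (hc₀ : 0 < c₀) (hcC : c₀ ≤ C₀) (hδ₀ : 0 < δ₀)
    (hA : 0 < A) (hT₀ : 0 < T₀) :
    ∃ δ : ℝ, 0 < δ ∧ ∀ t α a b : ℝ,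
      0 ≤ t → t ≤ T₀ → 0 ≤ α → α ≤ A →
      c₀ * (t + α) ≤ a → a ≤ C₀ * (t + α) →
      4 * a ^ 3 - 27 * b ^ 2 ≥ δ₀ * t * (t + α) ^ 2 →
      (!![3, 0, -a; 0, 2*a, 3*b; -a, 3*b, a^2]
        - (2 * δ * t) • Matrix.diagonal ![1, 1, a]).PosSemidef := by
  have hC₀ : 0 < C₀ := hc₀.trans_le hcC
  set K := C₀ ^ 2 * (8 + 2 * (C₀ * (T₀ + A))) with hK
  have hK0 : 0 < K := by positivity
  obtain ⟨δ, hδ, hδT, hδc, hδK⟩ :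
      ∃ δ : ℝ, 0 < δ ∧ 2 * δ * T₀ ≤ 1 ∧ 2 * δ ≤ c₀ ∧ 2 * δ * K ≤ δ₀ := by
    refine ⟨min (1 / T₀) (min c₀ (δ₀ / K)) / 2, by positivity, ?_, ?_, ?_⟩ <;>
      rw [mul_div_cancel₀ _ two_ne_zero]
    · exact (le_div_iff₀ hT₀).1 (min_le_left _ _)
    · exact (min_le_right _ _).trans (min_le_left _ _)
    · exact (le_div_iff₀ hK0).1 ((min_le_right _ _).trans (min_le_right _ _))
  refine ⟨δ, hδ, fun t α a b ht htT hα hαA hca haC hΔ => ?_⟩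
  have hu : 0 ≤ t + α := add_nonneg ht hα
  have ha : 0 ≤ a := (mul_nonneg hc₀.le hu).trans hca
  have hs1 : 2 * δ * t ≤ 1 := (by gcongr : 2 * δ * t ≤ 2 * δ * T₀).trans hδT
  have hsa : 2 * δ * t ≤ a := by
    refine le_trans ?_ hca
    gcongr
    linarith
  have hs : 0 ≤ 2 * δ * t := by positivity
  have hsK : 2 * δ * t * (a ^ 2 * (8 + 2 * a)) ≤ δ₀ * t * (t + α) ^ 2 := by
    calc 2 * δ * t * (a ^ 2 * (8 + 2 * a))
        ≤ 2 * δ * t * ((C₀ * (t + α)) ^ 2 * (8 + 2 * (C₀ * (T₀ + A)))) := by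
          have : a ≤ C₀ * (T₀ + A) := haC.trans (by gcongr)
          gcongr
      _ = 2 * δ * K * t * (t + α) ^ 2 := by rw [hK]; ring
      _ ≤ δ₀ * t * (t + α) ^ 2 := by gcongr
  have hdet := symmetrizer_shift_det_ge (b := b) ha hs (by linarith)
  generalize 2 * δ * t = s at *
  refine Matrix.PosSemidef.of_dotProduct_mulVec_nonneg ?_ fun v => ?_
  · ext i j
    fin_cases i <;> fin_cases j <;> simp
  · have hform : 0 ≤ (3 - s) * v 0 ^ 2 + (2 * a - s) * v 1 ^ 2 + (a ^ 2 - s * a) * v 2 ^ 2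
        - 2 * a * v 0 * v 2 + 2 * (3 * b) * v 1 * v 2 := by
      rcases ha.eq_or_lt with rfl | ha
      · have hb : b = 0 := by
          have : 0 ≤ δ₀ * t * (t + α) ^ 2 := by positivity
          exact pow_eq_zero_iff two_ne_zero |>.1 (by nlinarith [sq_nonneg b])
        obtain rfl : s = 0 := le_antisymm hsa hs
        subst hb
        nlinarith [sq_nonneg (v 0)]
      · exact ternary_form_nonneg (by linarith) (by linarith) (by linarith) _ _ _
    refine hform.trans_eq ?_
    simp [Matrix.mulVec, dotProduct, Fin.sum_univ_three, Matrix.diagonal_apply]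
    ring
end

section
/- For all constants c₀, C₀, δ₀, A > 0 with c₀ ≤ C₀ there exist ε₁ > 0 and T > 0 such that: for all real t, α with 0 ≤ t ≤ T and 0 ≤ α ≤ A, all real a, b satisfying c₀(t+α) ≤ a ≤ C₀(t+α) and 4a³ − 27b² ≥ δ₀ t(t+α)², and every real symmetric 3×3 matrix E whose entries satisfy |E₁₁| ≤ t, |E₁₂| ≤ t√a, |E₁₃| ≤ t, |E₂₂| ≤ t, |E₂₃| ≤ t√a, |E₃₃| ≤ t·a, the matrix S(a,b) + ε₁·E is positive semidefinite, where S(a,b) has rows (3, 0, −a), (0, 2a, 3b), (−a, 3b, a²). -/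
/-- Completing squares in the quadratic form of the symmetrizer: it dominates
`3 u ^ 2 + 2 a w ^ 2 + (δ / 6) t a z ^ 2`, and `u`, `w`, `z` control `x ^ 2 / a + y ^ 2 + a z ^ 2`. -/
lemma symmetrizer_form_lower_bound {c δ t a b : ℝ} (x y z : ℝ) (hδ : 0 ≤ δ) (ha : 0 < a)
    (ht : 0 ≤ t) (hta : c * t ≤ a) (hD : δ * t * a ^ 2 ≤ 4 * a ^ 3 - 27 * b ^ 2)
    {η : ℝ} (hη : 0 ≤ η) (hηc : η ≤ c) (hηδ : 12 * η ≤ δ) :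
    η * (t * (x ^ 2 / a + y ^ 2 + a * z ^ 2)) ≤
      3 * x ^ 2 + 2 * a * y ^ 2 + a ^ 2 * z ^ 2 - 2 * a * x * z + 6 * b * y * z := by
  obtain ⟨u, rfl⟩ : ∃ u, x = u + a * z / 3 := ⟨x - a * z / 3, by ring⟩
  obtain ⟨r, rfl⟩ : ∃ r, b = 2 * a * r / 3 := ⟨3 * b / (2 * a), by field_simp⟩
  obtain ⟨w, rfl⟩ : ∃ w, y = w - r * z := ⟨y + r * z, by ring⟩
  have hr : δ * t ≤ 4 * a - 12 * r ^ 2 := by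
    refine le_of_mul_le_mul_right ?_ (pow_pos ha 2)
    linarith
  have hδt : 0 ≤ δ * t := mul_nonneg hδ ht
  have hr' : r ^ 2 ≤ a / 3 := by linarith
  have hx : (u + a * z / 3) ^ 2 / a ≤ 2 * u ^ 2 / a + 2 / 9 * a * z ^ 2 := by
    have h : 2 * u ^ 2 / a + 2 / 9 * a * z ^ 2 = (2 * u ^ 2 + 2 * (a * z / 3) ^ 2) / a := by
      field_simp
      ring
    rw [h]
    gcongr
    linarith [sq_nonneg (u - a * z / 3)]
  have hy : (w - r * z) ^ 2 ≤ 2 * w ^ 2 + 2 / 3 * a * z ^ 2 := by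
    linarith [sq_nonneg (w + r * z), mul_le_mul_of_nonneg_right hr' (sq_nonneg z)]
  have hηt : η * t ≤ a := (mul_le_mul_of_nonneg_right hηc ht).trans hta
  have haz : 0 ≤ a * z ^ 2 := by positivity
  have hηt0 : 0 ≤ η * t := mul_nonneg hη ht
  have hu : η * t * (2 * u ^ 2 / a) ≤ 2 * u ^ 2 := by
    rw [← mul_div_assoc, div_le_iff₀ ha, mul_comm]
    gcongr
  have hw := mul_le_mul_of_nonneg_right hηt (sq_nonneg w)
  have hz := mul_le_mul_of_nonneg_right
    (mul_le_mul_of_nonneg_right hηδ ht) haz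
  have hq := mul_le_mul_of_nonneg_right hr haz
  calc η * (t * ((u + a * z / 3) ^ 2 / a + (w - r * z) ^ 2 + a * z ^ 2))
      = η * t * ((u + a * z / 3) ^ 2 / a + (w - r * z) ^ 2 + a * z ^ 2) := by ring
    _ ≤ η * t * ((2 * u ^ 2 / a + 2 / 9 * a * z ^ 2) + (2 * w ^ 2 + 2 / 3 * a * z ^ 2)
          + a * z ^ 2) := by gcongr
    _ ≤ 2 * u ^ 2 + 2 * a * w ^ 2 + 2 * (η * t) * (a * z ^ 2) := by
        linarith [mul_nonneg hηt0 haz]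
    _ ≤ _ := by linarith [sq_nonneg u]

/-- A quadratic form whose coefficients have the prescribed orders is bounded below. -/
lemma perturbation_form_lower_bound {t a M e₁₁ e₁₂ e₁₃ e₂₂ e₂₃ e₃₃ : ℝ} (x y z : ℝ)
    (ht : 0 ≤ t) (ha : 0 < a) (haM : a ≤ M)
    (h₁₁ : |e₁₁| ≤ t) (h₁₂ : |e₁₂| ≤ t * √a) (h₁₃ : |e₁₃| ≤ t)
    (h₂₂ : |e₂₂| ≤ t) (h₂₃ : |e₂₃| ≤ t * √a) (h₃₃ : |e₃₃| ≤ t * a) :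
    -((2 * M + 3) * (t * (x ^ 2 / a + y ^ 2 + a * z ^ 2))) ≤
      e₁₁ * x ^ 2 + e₂₂ * y ^ 2 + e₃₃ * z ^ 2
        + 2 * e₁₂ * x * y + 2 * e₁₃ * x * z + 2 * e₂₃ * y * z := by
  obtain ⟨s, hs, rfl⟩ : ∃ s, 0 < s ∧ a = s ^ 2 :=
    ⟨√a, Real.sqrt_pos.2 ha, (Real.sq_sqrt ha.le).symm⟩
  rw [Real.sqrt_sq hs.le] at h₁₂ h₂₃
  obtain ⟨v, rfl⟩ : ∃ v, x = s * v := ⟨x / s, by field_simp⟩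
  have hv : (s * v) ^ 2 / s ^ 2 = v ^ 2 := by field_simp
  rw [hv]
  have key : ∀ {e k p q : ℝ}, |e| ≤ k → -(k * (p ^ 2 + q ^ 2)) ≤ 2 * e * (p * q) := by
    intro e k p q h
    obtain ⟨h₁, h₂⟩ := abs_le.1 h
    nlinarith [mul_nonneg (sub_nonneg.2 h₂) (sq_nonneg (p - q)),
      mul_nonneg (neg_le_iff_add_nonneg.1 h₁) (sq_nonneg (p + q))]
  have d₁ := mul_le_mul_of_nonneg_right (abs_le.1 h₁₁).1 (sq_nonneg (s * v))
  have d₂ := mul_le_mul_of_nonneg_right (abs_le.1 h₂₂).1 (sq_nonneg y)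
  have d₃ := mul_le_mul_of_nonneg_right (abs_le.1 h₃₃).1 (sq_nonneg z)
  have k₁₂ : -(t * s ^ 2 * (v ^ 2 + y ^ 2)) ≤ 2 * (s * e₁₂) * (v * y) := by
    apply key
    rw [abs_mul, abs_of_pos hs]
    nlinarith
  have k₁₃ := key (p := v) (q := s * z) h₁₃
  have k₂₃ : -(t * (y ^ 2 + (s * z) ^ 2)) ≤ 2 * (e₂₃ / s) * (y * (s * z)) := by
    apply key
    rwa [abs_div, abs_of_pos hs, div_le_iff₀ hs]
  have e₂ : 2 * (e₂₃ / s) * (y * (s * z)) = 2 * e₂₃ * y * z := by field_simp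
  rw [e₂] at k₂₃
  have hM : 0 ≤ M := ha.le.trans haM
  have m₁ := mul_le_mul_of_nonneg_right haM (mul_nonneg ht (sq_nonneg v))
  have m₂ := mul_le_mul_of_nonneg_right haM (mul_nonneg ht (sq_nonneg y))
  have m₃ : 0 ≤ M * (t * (s * z) ^ 2) := by positivity
  have n₁ : 0 ≤ t * v ^ 2 := by positivity
  have n₂ : 0 ≤ M * (t * y ^ 2) := by positivity
  have n₃ : 0 ≤ t * y ^ 2 := by positivity
  linarith

/-- Eq. (3.19): S(a,b) + ε₁E ≫ 0 for symmetric perturbations E with the stated entry bounds. -/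
theorem stmt_15 (c₀ C₀ δ₀ A : ℝ) (hc₀ : 0 < c₀) (hcC : c₀ ≤ C₀) (hδ₀ : 0 < δ₀) (hA : 0 < A) :
    ∃ ε₁ : ℝ, 0 < ε₁ ∧ ∃ T : ℝ, 0 < T ∧ ∀ t α a b : ℝ, ∀ E : Matrix (Fin 3) (Fin 3) ℝ,
      0 ≤ t → t ≤ T → 0 ≤ α → α ≤ A →
      c₀ * (t + α) ≤ a → a ≤ C₀ * (t + α) →
      4 * a ^ 3 - 27 * b ^ 2 ≥ δ₀ * t * (t + α) ^ 2 →
      E.IsSymm →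
      |E 0 0| ≤ t → |E 0 1| ≤ t * Real.sqrt a → |E 0 2| ≤ t →
      |E 1 1| ≤ t → |E 1 2| ≤ t * Real.sqrt a → |E 2 2| ≤ t * a →
      (!![3, 0, -a; 0, 2*a, 3*b; -a, 3*b, a^2] + ε₁ • E).PosSemidef := by
  have hC₀ : 0 < C₀ := hc₀.trans_le hcC
  set M : ℝ := C₀ * (1 + A) with hM
  have hMpos : 0 < M := by positivity
  set δ : ℝ := δ₀ / C₀ ^ 2 with hδ
  have hδpos : 0 < δ := by positivity
  set η : ℝ := min c₀ (δ / 12)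
  have hηpos : 0 < η := lt_min hc₀ (by positivity)
  have hK : 0 < 2 * M + 3 := by positivity
  refine ⟨η / (2 * M + 3), by positivity, 1, one_pos, ?_⟩
  intro t α a b E ht htT hα hαA hca haC hD hE h₁₁ h₁₂ h₁₃ h₂₂ h₂₃ h₃₃
  have s₁ : E 1 0 = E 0 1 := hE.apply 0 1
  have s₂ : E 2 0 = E 0 2 := hE.apply 0 2
  have s₃ : E 2 1 = E 1 2 := hE.apply 1 2
  refine Matrix.PosSemidef.of_dotProduct_mulVec_nonneg ?_ fun x ↦ ?_
  · ext i j
    fin_cases i <;> fin_cases j <;> simp [s₁, s₂, s₃]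
  set ε : ℝ := η / (2 * M + 3)
  have hεpos : 0 < ε := by positivity
  have expand : star x ⬝ᵥ ((!![3, 0, -a; 0, 2*a, 3*b; -a, 3*b, a^2] + ε • E).mulVec x) =
      (3 * x 0 ^ 2 + 2 * a * x 1 ^ 2 + a ^ 2 * x 2 ^ 2 - 2 * a * x 0 * x 2 + 6 * b * x 1 * x 2)
      + ε * (E 0 0 * x 0 ^ 2 + E 1 1 * x 1 ^ 2 + E 2 2 * x 2 ^ 2
        + 2 * E 0 1 * x 0 * x 1 + 2 * E 0 2 * x 0 * x 2 + 2 * E 1 2 * x 1 * x 2) := by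
    simp [dotProduct, Matrix.mulVec, Fin.sum_univ_three, s₁, s₂, s₃]
    ring
  rw [expand]
  have ha₀ : 0 ≤ a := (by positivity : 0 ≤ c₀ * (t + α)).trans hca
  rcases ha₀.eq_or_lt with rfl | ha
  · have ht₀ : t = 0 := by linarith [nonpos_of_mul_nonpos_right hca hc₀]
    have hb : b = 0 := by
      have h : 0 ≤ δ₀ * t * (t + α) ^ 2 := by positivity
      exact pow_eq_zero_iff two_ne_zero |>.1 (by linarith [sq_nonneg b])
    subst ht₀ hb
    simp only [zero_mul, abs_nonpos_iff] at h₁₁ h₁₂ h₁₃ h₂₂ h₂₃ h₃₃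
    simp [h₁₁, h₁₂, h₁₃, h₂₂, h₂₃, h₃₃]
    positivity
  · have haM : a ≤ M := haC.trans (by rw [hM]; gcongr)
    have hta : c₀ * t ≤ a := le_trans (by gcongr; linarith) hca
    have hD' : δ * t * a ^ 2 ≤ 4 * a ^ 3 - 27 * b ^ 2 := by
      refine le_trans ?_ hD
      calc δ * t * a ^ 2 ≤ δ * t * (C₀ * (t + α)) ^ 2 := by gcongr
        _ = δ₀ * t * (t + α) ^ 2 := by rw [hδ]; field_simp
    have hS := symmetrizer_form_lower_bound (x 0) (x 1) (x 2) hδpos.le ha ht hta hD'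
      hηpos.le (min_le_left _ _) (by linarith [min_le_right c₀ (δ / 12)])
    have hP := mul_le_mul_of_nonneg_left
      (perturbation_form_lower_bound (x 0) (x 1) (x 2) ht ha haM h₁₁ h₁₂ h₁₃ h₂₂ h₂₃ h₃₃) hεpos.le
    have hεK : ε * (2 * M + 3) = η := div_mul_cancel₀ _ hK.ne'
    rw [mul_neg, ← mul_assoc, hεK] at hP
    linarith
end

section
/- For all constants c₀, C₀, δ₀, A, M > 0 with c₀ ≤ C₀ there exist ε₁ > 0 and T > 0 such that: for all real t, α with 0 ≤ t ≤ T and 0 ≤ α ≤ A, all real a, b satisfying c₀(t+α) ≤ a ≤ C₀(t+α) and 4a³ − 27b² ≥ δ₀ t(t+α)², and every real symmetric 3×3 matrix E with |E_{jk}| ≤ M t² for all j, k, the matrix S(a,b) − ε₁·E is positive semidefinite, where S(a,b) has rows (3, 0, −a), (0, 2a, 3b), (−a, 3b, a²). -/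
/-- A quadratic form with entries bounded by `m` is at most `m * card n` times the squared norm. -/
lemma Matrix.dotProduct_mulVec_le_of_abs_le {n : Type*} [Fintype n] {E : Matrix n n ℝ} {m : ℝ}
    (hE : ∀ i j, |E i j| ≤ m) (x : n → ℝ) :
    x ⬝ᵥ E.mulVec x ≤ m * Fintype.card n * ∑ i, x i ^ 2 := by
  have hterm (i j : n) : x i * (E i j * x j) ≤ m * ((x i ^ 2 + x j ^ 2) / 2) := by
    have h := abs_le.mp (hE i j)
    nlinarith [mul_nonneg (sub_nonneg.2 h.2) (sq_nonneg (x i + x j)),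
      mul_nonneg (neg_le_iff_add_nonneg.1 h.1) (sq_nonneg (x i - x j))]
  calc x ⬝ᵥ E.mulVec x = ∑ i, ∑ j, x i * (E i j * x j) := by
        simp only [dotProduct, Matrix.mulVec, Finset.mul_sum]
    _ ≤ ∑ i, ∑ j, m * ((x i ^ 2 + x j ^ 2) / 2) :=
        Finset.sum_le_sum fun i _ => Finset.sum_le_sum fun j _ => hterm i j
    _ = m * Fintype.card n * ∑ i, x i ^ 2 := by
        simp only [← Finset.mul_sum, ← Finset.sum_div, Finset.sum_add_distrib, Finset.sum_const,
          Finset.card_univ, nsmul_eq_mul]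
        ring

/-- Completing squares in the quadratic form of the symmetrizer gives a lower bound by a multiple
`K` of the squared norm, provided `K` is small compared with the discriminant. -/
lemma mul_sq_norm_le_symmetrizer {a b K : ℝ} (ha : 0 < a) (hK : 0 ≤ K) (hK1 : K ≤ 1)
    (hKa : K ≤ a) (hb : 27 * b ^ 2 ≤ 4 * a ^ 3)
    (hKd : K * (1 + 2 * a ^ 2 / 9 + 2 * a / 3) ≤ (4 * a ^ 3 - 27 * b ^ 2) / (6 * a))
    (x y z : ℝ) :
    K * (x ^ 2 + y ^ 2 + z ^ 2) ≤
      3 * x ^ 2 - 2 * a * x * z + 2 * a * y ^ 2 + 6 * b * y * z + a ^ 2 * z ^ 2 := by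
  set w := 3 * b / (2 * a) with hw
  have hQ : 3 * x ^ 2 - 2 * a * x * z + 2 * a * y ^ 2 + 6 * b * y * z + a ^ 2 * z ^ 2 =
      3 * (x - a * z / 3) ^ 2 + 2 * a * (y + w * z) ^ 2 +
        (4 * a ^ 3 - 27 * b ^ 2) / (6 * a) * z ^ 2 := by
    rw [hw]
    field_simp
    ring
  have hw2 : w ^ 2 ≤ a / 3 := by
    rw [hw, div_pow, div_le_iff₀ (by positivity)]
    nlinarith
  have hx : x ^ 2 ≤ 2 * (x - a * z / 3) ^ 2 + 2 * a ^ 2 / 9 * z ^ 2 := by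
    nlinarith [sq_nonneg (x - 2 * (a * z / 3))]
  have hy : y ^ 2 ≤ 2 * (y + w * z) ^ 2 + 2 * a / 3 * z ^ 2 := by
    nlinarith [sq_nonneg (y + 2 * (w * z)), mul_nonneg (sub_nonneg.2 hw2) (sq_nonneg z)]
  rw [hQ]
  calc K * (x ^ 2 + y ^ 2 + z ^ 2)
      ≤ K * (2 * (x - a * z / 3) ^ 2 + 2 * a ^ 2 / 9 * z ^ 2 +
          (2 * (y + w * z) ^ 2 + 2 * a / 3 * z ^ 2) + z ^ 2) := by gcongr
    _ = 2 * K * (x - a * z / 3) ^ 2 + 2 * K * (y + w * z) ^ 2 +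
          K * (1 + 2 * a ^ 2 / 9 + 2 * a / 3) * z ^ 2 := by ring
    _ ≤ _ := by
        gcongr
        linarith

/-- Lemma 3.5: S(a,b) - ε₁E ≫ 0 for symmetric perturbations E with all entries O(t²). -/
theorem stmt_16 (c₀ C₀ δ₀ A M : ℝ) (hc₀ : 0 < c₀) (hcC : c₀ ≤ C₀) (hδ₀ : 0 < δ₀)
    (hA : 0 < A) (hM : 0 < M) :
    ∃ ε₁ : ℝ, 0 < ε₁ ∧ ∃ T : ℝ, 0 < T ∧ ∀ t α a b : ℝ, ∀ E : Matrix (Fin 3) (Fin 3) ℝ,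
      0 ≤ t → t ≤ T → 0 ≤ α → α ≤ A →
      c₀ * (t + α) ≤ a → a ≤ C₀ * (t + α) →
      4 * a ^ 3 - 27 * b ^ 2 ≥ δ₀ * t * (t + α) ^ 2 →
      E.IsSymm →
      (∀ j k : Fin 3, |E j k| ≤ M * t ^ 2) →
      (!![3, 0, -a; 0, 2*a, 3*b; -a, 3*b, a^2] - ε₁ • E).PosSemidef := by
  have hC₀ : 0 < C₀ := hc₀.trans_le hcC
  set B := C₀ * (1 + A) with hB
  have hB0 : 0 < B := by positivity
  set D := 1 + 2 * B ^ 2 / 9 + 2 * B / 3 with hD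
  have hD0 : 0 < D := by positivity
  obtain ⟨κ, hκ0, hκ⟩ : ∃ κ : ℝ, 0 < κ ∧ κ ≤ min 1 (min c₀ (δ₀ / (6 * C₀) / D)) :=
    ⟨_, by positivity, le_rfl⟩
  obtain ⟨hκ1, hκc, hκd⟩ : κ ≤ 1 ∧ κ ≤ c₀ ∧ κ * D ≤ δ₀ / (6 * C₀) := by
    simpa only [le_min_iff, le_div_iff₀ hD0] using hκ
  refine ⟨κ / (3 * M), by positivity, 1, one_pos, ?_⟩
  intro t α a b E ht ht1 hα hαA hca haC hdisc hsymm hE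
  refine Matrix.PosSemidef.of_dotProduct_mulVec_nonneg ?_ fun x => ?_
  · refine Matrix.IsHermitian.sub ?_ ?_
    · ext i j
      fin_cases i <;> fin_cases j <;> simp
    · rw [Matrix.IsHermitian, Matrix.conjTranspose_eq_transpose_of_trivial, Matrix.transpose_smul,
        hsymm.eq]
  have hEx : κ / (3 * M) * (x ⬝ᵥ E.mulVec x) ≤ κ * t ^ 2 * (x 0 ^ 2 + x 1 ^ 2 + x 2 ^ 2) := by
    calc κ / (3 * M) * (x ⬝ᵥ E.mulVec x)
        ≤ κ / (3 * M) * (M * t ^ 2 * Fintype.card (Fin 3) * ∑ i, x i ^ 2) := by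
          gcongr
          exact Matrix.dotProduct_mulVec_le_of_abs_le hE x
      _ = _ := by
          rw [Fin.sum_univ_three, Fintype.card_fin]
          push_cast
          field_simp
  have hSx : κ * t ^ 2 * (x 0 ^ 2 + x 1 ^ 2 + x 2 ^ 2) ≤
      3 * x 0 ^ 2 - 2 * a * x 0 * x 2 + 2 * a * x 1 ^ 2 + 6 * b * x 1 * x 2 + a ^ 2 * x 2 ^ 2 := by
    have hs : 0 ≤ t + α := add_nonneg ht hα
    rcases hs.eq_or_lt with hs0 | hs0
    · obtain rfl : t = 0 := by linarith
      obtain rfl : α = 0 := by linarith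
      obtain rfl : a = 0 := by linarith
      obtain rfl : b = 0 := by
        have : b ^ 2 ≤ 0 := by linarith
        exact pow_eq_zero_iff two_ne_zero |>.1 (this.antisymm (sq_nonneg b))
      nlinarith [sq_nonneg (x 0)]
    · have ha : 0 < a := (mul_pos hc₀ hs0).trans_le hca
      have haB : a ≤ B := haC.trans (by rw [hB]; gcongr)
      have ht2 : t ^ 2 ≤ t := by nlinarith
      refine mul_sq_norm_le_symmetrizer ha (by positivity) (by nlinarith) ?_ ?_ ?_ _ _ _
      · calc κ * t ^ 2 ≤ c₀ * (t + α) := by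
              gcongr
              linarith
          _ ≤ a := hca
      · have : 0 ≤ δ₀ * t * (t + α) ^ 2 := by positivity
        linarith
      · calc κ * t ^ 2 * (1 + 2 * a ^ 2 / 9 + 2 * a / 3) ≤ κ * t ^ 2 * D := by
              rw [hD]
              gcongr
          _ = κ * D * t ^ 2 := by ring
          _ ≤ δ₀ / (6 * C₀) * (t * (t + α)) := by
              gcongr
              nlinarith
          _ = δ₀ * t * (t + α) ^ 2 / (6 * (C₀ * (t + α))) := by
              field_simp
          _ ≤ (4 * a ^ 3 - 27 * b ^ 2) / (6 * a) := by
              have : 0 ≤ δ₀ * t * (t + α) ^ 2 := by positivity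
              gcongr
              linarith
  have hS : x ⬝ᵥ (!![3, 0, -a; 0, 2*a, 3*b; -a, 3*b, a^2] : Matrix (Fin 3) (Fin 3) ℝ).mulVec x =
      3 * x 0 ^ 2 - 2 * a * x 0 * x 2 + 2 * a * x 1 ^ 2 + 6 * b * x 1 * x 2 + a ^ 2 * x 2 ^ 2 := by
    simp [dotProduct, Matrix.mulVec, Fin.sum_univ_three]
    ring
  rw [star_trivial, Matrix.sub_mulVec, Matrix.smul_mulVec, dotProduct_sub, dotProduct_smul,
    smul_eq_mul, hS]
  linarith
end

section
/- For all constants c₀, δ₀ > 0 there exists δ' > 0 such that: for all real numbers t ≥ 0, α ≥ 0, s ≥ 0, every real ã with ã ≥ c₀, and every real b, if 4(t+α)³ ã³ − 27b² ≥ δ₀ t(t+α)², then 4(t+α+s)³ ã³ − 27b² ≥ δ' t(t+α+s)². -/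
/-- Lemma 4.1 (core computation): condition (E) is preserved when α is enlarged by s ≥ 0. -/
theorem stmt_17 (c₀ δ₀ : ℝ) (hc₀ : 0 < c₀) (hδ₀ : 0 < δ₀) :
    ∃ δ' : ℝ, 0 < δ' ∧ ∀ t α s ta b : ℝ,
      0 ≤ t → 0 ≤ α → 0 ≤ s → c₀ ≤ ta →
      4 * (t + α) ^ 3 * ta ^ 3 - 27 * b ^ 2 ≥ δ₀ * t * (t + α) ^ 2 →
      4 * (t + α + s) ^ 3 * ta ^ 3 - 27 * b ^ 2 ≥ δ' * t * (t + α + s) ^ 2 := by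
  refine ⟨min (δ₀ / 2) (6 * c₀ ^ 3), by positivity, ?_⟩
  intro t α s ta b ht hα hs hta h
  have hδ : min (δ₀ / 2) (6 * c₀ ^ 3) ≤ δ₀ / 2 := min_le_left _ _
  have hc : min (δ₀ / 2) (6 * c₀ ^ 3) ≤ 6 * c₀ ^ 3 := min_le_right _ _
  have hpos : 0 < min (δ₀ / 2) (6 * c₀ ^ 3) := by positivity
  generalize min (δ₀ / 2) (6 * c₀ ^ 3) = δ' at *
  have hcube : c₀ ^ 3 ≤ ta ^ 3 := by gcongr
  have htu : t ≤ t + α := by linarith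
  generalize t + α = u at *
  have hu : 0 ≤ u := ht.trans htu
  have hta3 : 0 ≤ ta ^ 3 := (pow_pos hc₀ 3).le.trans hcube
  have hsq : δ' * t * (u + s) ^ 2 ≤ δ' * t * (2 * u ^ 2 + 2 * s ^ 2) := by
    gcongr
    linarith [sq_nonneg (u - s)]
  have hmain : δ' * (t * u ^ 2) ≤ δ₀ / 2 * (t * u ^ 2) := by gcongr
  have hshift : δ' * (t * s ^ 2) ≤ 6 * ta ^ 3 * (u * s ^ 2) := by
    have hδta : δ' ≤ 6 * ta ^ 3 := by linarith
    gcongr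
  have hrest : 0 ≤ ta ^ 3 * (s * (3 * u ^ 2 + s ^ 2)) := by positivity
  linarith
end
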